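/- In the overlap array setup, suppose μ satisfies the Ghirlanda–Guerra identities for system 2, and take A₁ = [0,1]. Then for every n ≥ 1 and all Borel sets A ⊆ [−1,1], A₂ ⊆ [0,1], one has μ(B_n) ≥ μ₂(A₂)^{n−1} · μ_{1,2}(A). -/

import Mathlib

open MeasureTheory

namespace OverlapArray

/-- The space `([-1,1]^{ℕ×ℕ})³` of triples of overlap arrays
`((R¹_{l,l'}), (R²_{l,l'}), (R_{l,l'}))` (realized inside `(ℝ^{ℕ×ℕ})³`, the constraint that
entries lie in `[-1,1]` being imposed almost surely). -/
abbrev OA : Type := (ℕ → ℕ → ℝ) × (ℕ → ℕ → ℝ) × (ℕ → ℕ → ℝ)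

/-- The overlap array `(R¹_{l,l'})` of the first system. -/
def R1 (ω : OA) : ℕ → ℕ → ℝ := ω.1

/-- The overlap array `(R²_{l,l'})` of the second system. -/
def R2 (ω : OA) : ℕ → ℕ → ℝ := ω.2.1

/-- The array `(R_{l,l'})` of cross overlaps. -/
def R (ω : OA) : ℕ → ℕ → ℝ := ω.2.2

/-- Relabelling the replicas of the first system by `π` and of the second system by `π'`. -/
def permMap (π π' : Equiv.Perm ℕ) (ω : OA) : OA :=
  (fun l l' => R1 ω (π l) (π l'), fun l l' => R2 ω (π' l) (π' l'),
   fun l l' => R ω (π l) (π' l'))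

/-- The overlap array setup: `μ` is a probability measure on `OA` with entries a.s. in
`[-1,1]`, `R¹, R²` a.s. symmetric with unit diagonal, and `μ` invariant under finitely
supported permutations of the replicas of each system. -/
structure Setup (μ : Measure OA) : Prop where
  prob : IsProbabilityMeasure μ
  bounded : ∀ᵐ ω ∂μ, ∀ l l', |R1 ω l l'| ≤ 1 ∧ |R2 ω l l'| ≤ 1 ∧ |R ω l l'| ≤ 1
  symm : ∀ᵐ ω ∂μ, ∀ l l', R1 ω l l' = R1 ω l' l ∧ R2 ω l l' = R2 ω l' l
  diag : ∀ᵐ ω ∂μ, ∀ l, R1 ω l l = 1 ∧ R2 ω l l = 1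
  exch : ∀ π π' : Equiv.Perm ℕ, {x | π x ≠ x}.Finite → {x | π' x ≠ x}.Finite →
    μ.map (permMap π π') = μ

/-- Evaluation of a function `f` of the overlaps on the first `n` replicas. -/
def fRep (n : ℕ)
    (f : ((Fin n → Fin n → ℝ) × (Fin n → Fin n → ℝ) × (Fin n → Fin n → ℝ)) → ℝ)
    (ω : OA) : ℝ :=
  f (fun l l' => R1 ω l.val l'.val, fun l l' => R2 ω l.val l'.val,
     fun l l' => R ω l.val l'.val)

/-- The Ghirlanda–Guerra identities for system 1: for every `n ≥ 1`, every bounded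
measurable function `f` of the overlaps on `n` replicas and every bounded Borel even
`ψ : [-1,1] → ℝ`,
`E[f·ψ(R¹_{1,n+1})] = (1/n) E[f]·E[ψ(R¹_{1,2})] + (1/n) ∑_{l=2}^n E[f·ψ(R¹_{1,l})]`
(replicas are indexed from `0` here, so `R¹_{1,l}` is `R1 ω 0 (l-1)`). -/
def GG1 (μ : Measure OA) : Prop :=
  ∀ n : ℕ, 1 ≤ n →
  ∀ f : ((Fin n → Fin n → ℝ) × (Fin n → Fin n → ℝ) × (Fin n → Fin n → ℝ)) → ℝ,
    Measurable f → (∃ C, ∀ v, |f v| ≤ C) →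
  ∀ ψ : ℝ → ℝ, Measurable ψ → (∃ C, ∀ x, |ψ x| ≤ C) → (∀ x, ψ (-x) = ψ x) →
    ∫ ω, fRep n f ω * ψ (R1 ω 0 n) ∂μ
      = (1 / n) * (∫ ω, fRep n f ω ∂μ) * (∫ ω, ψ (R1 ω 0 1) ∂μ)
        + (1 / n) * ∑ l ∈ Finset.Ico 1 n, ∫ ω, fRep n f ω * ψ (R1 ω 0 l) ∂μ

/-- The Ghirlanda–Guerra identities for system 2. -/
def GG2 (μ : Measure OA) : Prop :=
  ∀ n : ℕ, 1 ≤ n →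
  ∀ f : ((Fin n → Fin n → ℝ) × (Fin n → Fin n → ℝ) × (Fin n → Fin n → ℝ)) → ℝ,
    Measurable f → (∃ C, ∀ v, |f v| ≤ C) →
  ∀ ψ : ℝ → ℝ, Measurable ψ → (∃ C, ∀ x, |ψ x| ≤ C) → (∀ x, ψ (-x) = ψ x) →
    ∫ ω, fRep n f ω * ψ (R2 ω 0 n) ∂μ
      = (1 / n) * (∫ ω, fRep n f ω ∂μ) * (∫ ω, ψ (R2 ω 0 1) ∂μ)
        + (1 / n) * ∑ l ∈ Finset.Ico 1 n, ∫ ω, fRep n f ω * ψ (R2 ω 0 l) ∂μ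

/-- The event `{R_{1,1} ∈ A}`. -/
def EA (A : Set ℝ) : Set OA := {ω | R ω 0 0 ∈ A}

/-- The event `{|R¹_{l,l'}| ∈ A₁ for all l ≠ l' ≤ n}` (with `0`-based replica indices). -/
def E1 (n : ℕ) (A1 : Set ℝ) : Set OA :=
  {ω | ∀ l l', l < n → l' < n → l ≠ l' → |R1 ω l l'| ∈ A1}

/-- The event `{|R²_{l,l'}| ∈ A₂ for all l ≠ l' ≤ n}` (with `0`-based replica indices). -/
def E2 (n : ℕ) (A2 : Set ℝ) : Set OA :=
  {ω | ∀ l l', l < n → l' < n → l ≠ l' → |R2 ω l l'| ∈ A2}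

/-- The event `B_n`. -/
def Bev (n : ℕ) (A A1 A2 : Set ℝ) : Set OA := EA A ∩ E1 n A1 ∩ E2 n A2

/-- The event `C_n`. -/
def Cev (n : ℕ) (A A1 A2 : Set ℝ) : Set OA := EA A ∩ E1 (n + 1) A1 ∩ E2 n A2

end OverlapArray

open OverlapArray

namespace OverlapArray

lemma meas_R (i j : ℕ) : Measurable (fun ω : OA => R ω i j) := by
  unfold R; fun_prop

lemma meas_R2 (i j : ℕ) : Measurable (fun ω : OA => R2 ω i j) := by
  unfold R2; fun_prop

lemma meas_permMap (π π' : Equiv.Perm ℕ) : Measurable (permMap π π') := by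
  unfold permMap R1 R2 R; fun_prop

lemma meas_absR2 {A2 : Set ℝ} (hA2 : MeasurableSet A2) (i j : ℕ) :
    MeasurableSet {ω : OA | |R2 ω i j| ∈ A2} :=
  ((meas_R2 i j).abs) hA2

lemma meas_E2 {A2 : Set ℝ} (hA2 : MeasurableSet A2) (n : ℕ) : MeasurableSet (E2 n A2) := by
  have : E2 n A2 = ⋂ l, ⋂ l', ⋂ (_ : l < n), ⋂ (_ : l' < n), ⋂ (_ : l ≠ l'),
      {ω : OA | |R2 ω l l'| ∈ A2} := by
    ext ω; simp [E2]
  rw [this]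
  exact .iInter fun l => .iInter fun l' => .iInter fun _ => .iInter fun _ => .iInter fun _ =>
    meas_absR2 hA2 l l'

/-- The event `{R_{0,l} ∈ A}` intersected with `E2`. -/
def Fev (n l : ℕ) (A A2 : Set ℝ) : Set OA := {ω | R ω 0 l ∈ A} ∩ E2 n A2

lemma meas_Fev {A A2 : Set ℝ} (hA : MeasurableSet A) (hA2 : MeasurableSet A2) (n l : ℕ) :
    MeasurableSet (Fev n l A A2) :=
  ((meas_R 0 l) hA).inter (meas_E2 hA2 n)

lemma gg_step (μ : Measure OA) (hs : Setup μ) (hGG : GG2 μ) (n l : ℕ) (hl : l < n)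
    {A A2 : Set ℝ} (hA : MeasurableSet A) (hA2 : MeasurableSet A2) :
    μ.real (Fev n l A A2 ∩ {ω | |R2 ω 0 n| ∈ A2}ᶜ)
      = (1 / n) * μ.real (Fev n l A A2) * μ.real {ω | |R2 ω 0 1| ∈ A2}ᶜ := by
  have := hs.prob
  have hn : 0 < n := by omega
  let S : Set ((Fin n → Fin n → ℝ) × (Fin n → Fin n → ℝ) × (Fin n → Fin n → ℝ)) :=
    {v | v.2.2 ⟨0, hn⟩ ⟨l, hl⟩ ∈ A} ∩
      ⋂ i : Fin n, ⋂ j : Fin n, ⋂ (_ : i ≠ j), {v | |v.2.1 i j| ∈ A2}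
  have hS : MeasurableSet S := by
    refine MeasurableSet.inter ?_ (.iInter fun i => .iInter fun j => .iInter fun _ => ?_)
    · have h : Measurable (fun v : (Fin n → Fin n → ℝ) × (Fin n → Fin n → ℝ) ×
        (Fin n → Fin n → ℝ) => v.2.2 ⟨0, hn⟩ ⟨l, hl⟩) := by fun_prop
      exact h hA
    · have h : Measurable (fun v : (Fin n → Fin n → ℝ) × (Fin n → Fin n → ℝ) ×
        (Fin n → Fin n → ℝ) => |v.2.1 i j|) := by
          have h0 : Measurable (fun v : (Fin n → Fin n → ℝ) × (Fin n → Fin n → ℝ) ×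
            (Fin n → Fin n → ℝ) => v.2.1 i j) := by fun_prop
          exact h0.abs
      exact h hA2
  let T : Set ℝ := {x | |x| ∈ A2}ᶜ
  have hT : MeasurableSet T := by
    have h : Measurable (fun x : ℝ => |x|) := measurable_id.abs
    exact (h hA2).compl
  have key := hGG n hn (S.indicator 1) (measurable_one.indicator hS)
    ⟨1, fun v => by by_cases h : v ∈ S <;> simp [h]⟩ (T.indicator 1)
    (measurable_one.indicator hT)
    ⟨1, fun v => by by_cases h : v ∈ T <;> simp [h]⟩
    (fun x => by
      have : (-x ∈ T) ↔ x ∈ T := by simp [T]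
      by_cases h : x ∈ T <;> simp [h, this])
  have hf : ∀ ω, fRep n (S.indicator 1) ω = (Fev n l A A2).indicator 1 ω := by
    intro ω
    have : ((fun a b => R1 ω a.val b.val, fun a b => R2 ω a.val b.val,
     fun a b => R ω a.val b.val) : (Fin n → Fin n → ℝ) × (Fin n → Fin n → ℝ) ×
        (Fin n → Fin n → ℝ)) ∈ S ↔ ω ∈ Fev n l A A2 := by
      simp only [S, Fev, E2, Set.mem_inter_iff, Set.mem_setOf_eq, Set.mem_iInter]
      refine and_congr Iff.rfl ⟨fun h a b ha hb hab => ?_, fun h i j hij => ?_⟩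
      · exact h ⟨a, ha⟩ ⟨b, hb⟩ (by simpa using hab)
      · exact h i j i.2 j.2 (fun h => hij (Fin.ext h))
    unfold fRep
    by_cases h : ω ∈ Fev n l A A2
    · rw [Set.indicator_of_mem h, Set.indicator_of_mem (this.2 h)]; rfl
    · rw [Set.indicator_of_notMem h, Set.indicator_of_notMem (fun h' => h (this.1 h'))]
  have hψ : ∀ (k : ℕ) ω, T.indicator (1 : ℝ → ℝ) (R2 ω 0 k)
      = ({ω | |R2 ω 0 k| ∈ A2}ᶜ : Set OA).indicator 1 ω := by
    intro k ω
    by_cases h : |R2 ω 0 k| ∈ A2 <;> simp [T, h]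
  have hz : ∀ k ∈ Finset.Ico 1 n,
      ∫ ω, fRep n (S.indicator 1) ω * T.indicator (1 : ℝ → ℝ) (R2 ω 0 k) ∂μ = 0 := by
    intro k hk
    rw [Finset.mem_Ico] at hk
    rw [← integral_zero OA ℝ (μ := μ)]
    congr 1
    ext ω
    rw [hf, hψ]
    by_cases h : ω ∈ Fev n l A A2
    · have h2 : |R2 ω 0 k| ∈ A2 := h.2 0 k hn hk.2 (by omega)
      simp [h2]
    · simp [h]
  rw [Finset.sum_eq_zero hz] at key
  simp only [hf, hψ] at key
  have hF := meas_Fev hA hA2 n l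
  have hprod : ∀ ω, (Fev n l A A2).indicator (1 : OA → ℝ) ω *
      ({ω | |R2 ω 0 n| ∈ A2}ᶜ : Set OA).indicator 1 ω
      = (Fev n l A A2 ∩ {ω | |R2 ω 0 n| ∈ A2}ᶜ).indicator 1 ω := by
    intro ω
    rw [Set.inter_indicator_one]; rfl
  simp only [hprod] at key
  rw [integral_indicator_one (hF.inter (meas_absR2 hA2 0 n).compl),
    integral_indicator_one hF, integral_indicator_one (meas_absR2 hA2 0 1).compl] at key
  simpa using key

lemma swap_fin (l : ℕ) : {x | Equiv.swap 0 l x ≠ x}.Finite := by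
  refine (Set.toFinite {0, l}).subset fun x hx => ?_
  by_contra h
  simp only [Set.mem_insert_iff, Set.mem_singleton_iff, not_or] at h
  exact hx (Equiv.swap_apply_of_ne_of_ne h.1 h.2)

lemma swap_lt {n l i : ℕ} (hl : l < n) (hi : i < n) : Equiv.swap 0 l i < n := by
  rw [Equiv.swap_apply_def]; split_ifs <;> omega

lemma map_swap (μ : Measure OA) (hs : Setup μ) (l : ℕ) {S : Set OA} (hS : MeasurableSet S) :
    μ.real (permMap 1 (Equiv.swap 0 l) ⁻¹' S) = μ.real S := by
  conv_rhs => rw [← hs.exch 1 (Equiv.swap 0 l) (by simp) (swap_fin l)]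
  rw [map_measureReal_apply (meas_permMap _ _) hS]

lemma pre_Fev {n l : ℕ} (hl : l < n) (A A2 : Set ℝ) :
    permMap 1 (Equiv.swap 0 l) ⁻¹' (Fev n 0 A A2) = Fev n l A A2 := by
  ext ω
  simp only [Fev, E2, Set.mem_preimage, Set.mem_inter_iff, Set.mem_setOf_eq]
  have e : R (permMap 1 (Equiv.swap 0 l) ω) 0 0 = R ω 0 l := by
    simp [permMap, R]
  rw [e]
  refine and_congr Iff.rfl ⟨fun h a b ha hb hab => ?_, fun h a b ha hb hab => ?_⟩
  · have := h (Equiv.swap 0 l a) (Equiv.swap 0 l b) (swap_lt hl ha) (swap_lt hl hb)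
      (fun h => hab ((Equiv.swap 0 l).injective h))
    simpa [permMap, R2] using this
  · exact h (Equiv.swap 0 l a) (Equiv.swap 0 l b) (swap_lt hl ha) (swap_lt hl hb)
      (fun h => hab ((Equiv.swap 0 l).injective h))

lemma gg_step' (μ : Measure OA) (hs : Setup μ) (hGG : GG2 μ) (n l : ℕ) (hl : l < n)
    {A A2 : Set ℝ} (hA : MeasurableSet A) (hA2 : MeasurableSet A2) :
    μ.real (Fev n 0 A A2 ∩ {ω | |R2 ω l n| ∈ A2}ᶜ)
      = (1 / n) * μ.real (Fev n 0 A A2) * μ.real {ω | |R2 ω 0 1| ∈ A2}ᶜ := by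
  have h1 := map_swap μ hs l (meas_Fev hA hA2 n 0)
  have h2 := map_swap μ hs l ((meas_Fev hA hA2 n 0).inter (meas_absR2 hA2 l n).compl)
  have e : permMap 1 (Equiv.swap 0 l) ⁻¹' {ω | |R2 ω l n| ∈ A2}ᶜ
      = {ω | |R2 ω 0 n| ∈ A2}ᶜ := by
    ext ω
    have : Equiv.swap 0 l n = n := Equiv.swap_apply_of_ne_of_ne (by omega) (by omega)
    simp [permMap, R2, this]
  rw [Set.preimage_inter, pre_Fev hl, e] at h2
  rw [pre_Fev hl] at h1
  rw [← h2, ← h1]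
  exact gg_step μ hs hGG n l hl hA hA2

lemma ind_step (μ : Measure OA) (hs : Setup μ) (hGG : GG2 μ) (n : ℕ) (hn : 1 ≤ n)
    {A A2 : Set ℝ} (hA : MeasurableSet A) (hA2 : MeasurableSet A2) :
    μ.real {ω | |R2 ω 0 1| ∈ A2} * μ.real (Fev n 0 A A2) ≤ μ.real (Fev (n + 1) 0 A A2) := by
  have := hs.prob
  have hcov : (Fev n 0 A A2 : Set OA) ≤ᵐ[μ] (Fev (n + 1) 0 A A2 ∪
      ⋃ l ∈ Finset.range n, (Fev n 0 A A2 ∩ {ω | |R2 ω l n| ∈ A2}ᶜ) : Set OA) := by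
    filter_upwards [hs.symm] with ω hsy hω
    by_cases h : ∀ l < n, |R2 ω l n| ∈ A2
    · refine Or.inl ⟨hω.1, fun a b ha hb hab => ?_⟩
      rcases Nat.lt_succ_iff_lt_or_eq.1 ha with ha | rfl <;>
        rcases Nat.lt_succ_iff_lt_or_eq.1 hb with hb | rfl
      · exact hω.2 a b ha hb hab
      · exact h a ha
      · rw [(hsy _ _).2]; exact h b hb
      · exact absurd rfl hab
    · push Not at h
      obtain ⟨l, hl, h⟩ := h
      refine Or.inr ?_
      simp only [Set.mem_iUnion, Finset.mem_range]
      exact ⟨l, hl, hω, h⟩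
  have h1 : μ.real (Fev n 0 A A2) ≤ μ.real (Fev (n + 1) 0 A A2 ∪
      ⋃ l ∈ Finset.range n, (Fev n 0 A A2 ∩ {ω | |R2 ω l n| ∈ A2}ᶜ) : Set OA) :=
    ENNReal.toReal_mono (measure_ne_top _ _) (measure_mono_ae hcov)
  have h2 := measureReal_union_le (μ := μ) (Fev (n + 1) 0 A A2)
    (⋃ l ∈ Finset.range n, (Fev n 0 A A2 ∩ {ω | |R2 ω l n| ∈ A2}ᶜ))
  have h3 := measureReal_biUnion_finset_le (μ := μ) (Finset.range n)
    (fun l => Fev n 0 A A2 ∩ {ω | |R2 ω l n| ∈ A2}ᶜ)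
  rw [Finset.sum_congr rfl fun l hl =>
    gg_step' μ hs hGG n l (Finset.mem_range.1 hl) hA hA2] at h3
  rw [Finset.sum_const, Finset.card_range, nsmul_eq_mul,
    probReal_compl_eq_one_sub (meas_absR2 hA2 0 1)] at h3
  have hn' : (n : ℝ) ≠ 0 := by positivity
  have e : (n : ℝ) * (1 / n * μ.real (Fev n 0 A A2) * (1 - μ.real {ω | |R2 ω 0 1| ∈ A2}))
    = μ.real (Fev n 0 A A2) - μ.real {ω | |R2 ω 0 1| ∈ A2} * μ.real (Fev n 0 A A2) := by
    field_simp
  linarith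

lemma main_real (μ : Measure OA) (hs : Setup μ) (hGG : GG2 μ) (n : ℕ)
    {A A2 : Set ℝ} (hA : MeasurableSet A) (hA2 : MeasurableSet A2) :
    μ.real {ω | |R2 ω 0 1| ∈ A2} ^ n * μ.real {ω | R ω 0 0 ∈ A}
      ≤ μ.real (Fev (n + 1) 0 A A2) := by
  induction n with
  | zero =>
    have : Fev (0 + 1) 0 A A2 = {ω | R ω 0 0 ∈ A} := by
      ext ω
      simp only [Fev, E2, Set.mem_inter_iff, Set.mem_setOf_eq, and_iff_left_iff_imp]
      intro _ a b ha hb hab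
      omega
    rw [this]; simp
  | succ k ih =>
    refine le_trans ?_ (ind_step μ hs hGG (k + 1) (by omega) hA hA2)
    rw [pow_succ', mul_assoc]
    exact mul_le_mul_of_nonneg_left ih measureReal_nonneg

end OverlapArray

/-- In the overlap array setup, if `μ` satisfies the Ghirlanda–Guerra
identities for system 2 and `A₁ = [0,1]`, then for every `n ≥ 1` and all Borel sets
`A ⊆ [-1,1]`, `A₂ ⊆ [0,1]`, one has `μ(B_n) ≥ μ₂(A₂)^{n−1} · μ_{1,2}(A)`. -/
theorem statement_11 (μ : Measure OA) (hsetup : Setup μ) (hGG : GG2 μ)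
    (n : ℕ) (hn : 1 ≤ n) (A A2 : Set ℝ)
    (hA : MeasurableSet A) (hA2 : MeasurableSet A2)
    (hAsub : A ⊆ Set.Icc (-1) 1) (hA2sub : A2 ⊆ Set.Icc 0 1) :
    μ (Bev n A (Set.Icc 0 1) A2)
      ≥ μ {ω | |R2 ω 0 1| ∈ A2} ^ (n - 1) * μ {ω | R ω 0 0 ∈ A} := by
  have := hsetup.prob
  obtain ⟨k, rfl⟩ : ∃ k, n = k + 1 := ⟨n - 1, by omega⟩
  have h := main_real μ hsetup hGG k hA hA2
  have hle : (Fev (k + 1) 0 A A2 : Set OA) ≤ᵐ[μ] (Bev (k + 1) A (Set.Icc 0 1) A2 : Set OA) := by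
    filter_upwards [hsetup.bounded] with ω hb hω
    exact ⟨⟨hω.1, fun l l' _ _ _ => ⟨abs_nonneg _, (hb l l').1⟩⟩, hω.2⟩
  refine le_trans ?_ (measure_mono_ae hle)
  rw [← ENNReal.toReal_le_toReal (by finiteness) (by finiteness)]
  simpa [Measure.real] using h
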